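/- arXiv:2209.04172 — 5 statements merged into one kernel-verified Lean document; each statement's English description precedes it below -/
import Mathlib

section
/- Let h : (0,∞) → ℝ be differentiable with t·h(t) ∈ [0,1) for all t > 0, satisfying h(t)^{2d-1}·(h(t) + t·h'(t)) = e^{-t²}/d! for all t > 0 and lim_{t→∞} t·h(t) = 1, where d ≥ 1 is an integer. Then h = f_d, i.e., h(t) = (1/t)·(1 − e^{-t²} Σ_{k=0}^{d-1} t^{2k}/k!)^{1/(2d)} for all t > 0. -/
open MeasureTheory Real Finset Set Filter

/-- The derivative of `e^{-s} Σ_{k ≤ n} s^k/k!` telescopes to `-e^{-s} s^n/n!`. -/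
theorem hasDerivAt_exp_neg_mul_sum_pow_div_factorial (n : ℕ) (s : ℝ) :
    HasDerivAt (fun s : ℝ => Real.exp (-s) * ∑ k ∈ Finset.range (n + 1), s ^ k / (k.factorial : ℝ))
      (-(Real.exp (-s) * (s ^ n / (n.factorial : ℝ)))) s := by
  have hexp : HasDerivAt (fun s : ℝ => Real.exp (-s)) (-Real.exp (-s)) s := by
    simpa using (hasDerivAt_neg s).exp
  induction n with
  | zero => simpa using hexp
  | succ n ih =>
    have hterm := hexp.mul ((hasDerivAt_pow (n + 1) s).div_const ((n + 1).factorial : ℝ))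
    refine ((ih.add hterm).congr_of_eventuallyEq (.of_forall fun x => ?_)).congr_deriv ?_
    · simp [Finset.sum_range_succ _ (n + 1), mul_add]
    · have hn : (n.factorial : ℝ) ≠ 0 := by positivity
      rw [Nat.factorial_succ]
      push_cast
      field_simp
      ring

theorem tendsto_exp_neg_mul_sum_pow_div_factorial (n : ℕ) :
    Tendsto (fun s : ℝ => Real.exp (-s) * ∑ k ∈ Finset.range n, s ^ k / (k.factorial : ℝ))
      atTop (nhds 0) := by
  have hsum := tendsto_finsetSum (Finset.range n) fun k _ =>
    (Real.tendsto_pow_mul_exp_neg_atTop_nhds_zero k).div_const (k.factorial : ℝ)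
  simp only [zero_div, Finset.sum_const_zero] at hsum
  refine hsum.congr fun s => ?_
  rw [Finset.mul_sum]
  exact Finset.sum_congr rfl fun k _ => by ring

/-- A function with vanishing derivative on `(0, ∞)` equals its limit at infinity there. -/
theorem eq_of_hasDerivAt_zero_of_tendsto_atTop {F : ℝ → ℝ} {c : ℝ}
    (hF : ∀ t, 0 < t → HasDerivAt F 0 t) (hlim : Tendsto F atTop (nhds c)) {t : ℝ} (ht : 0 < t) :
    F t = c := by
  refine tendsto_nhds_unique (tendsto_const_nhds.congr' ?_) hlim
  filter_upwards [eventually_gt_atTop 0] with x hx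
  exact isOpen_Ioi.is_const_of_deriv_eq_zero isPreconnected_Ioi
    (fun y hy => (hF y hy).differentiableAt.differentiableWithinAt)
    (fun y hy => (hF y hy).deriv) (Set.mem_Ioi.2 ht) (Set.mem_Ioi.2 hx)

/-- Let `d ≥ 1` be an integer and let `h : (0,∞) → ℝ` be differentiable with
`t·h(t) ∈ [0,1)` for all `t > 0`, satisfying the ODE
`h(t)^(2d-1)·(h(t) + t·h'(t)) = e^{-t²}/d!` for all `t > 0` and `t·h(t) → 1` as `t → ∞`.
Then `h = f_d`, i.e. `h(t) = (1/t)·(1 − e^{-t²} Σ_{k=0}^{d-1} t^(2k)/k!)^(1/(2d))` for all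
`t > 0`. -/
theorem ode_uniqueness_fd
    (d : ℕ) (hd : 1 ≤ d) (h : ℝ → ℝ)
    (hdiff : ∀ t : ℝ, 0 < t → DifferentiableAt ℝ h t)
    (hrange : ∀ t : ℝ, 0 < t → t * h t ∈ Set.Ico (0 : ℝ) 1)
    (hode : ∀ t : ℝ, 0 < t →
      h t ^ (2 * d - 1) * (h t + t * deriv h t) = Real.exp (-t ^ 2) / (Nat.factorial d : ℝ))
    (hlim : Filter.Tendsto (fun t : ℝ => t * h t) Filter.atTop (nhds 1)) :
    ∀ t : ℝ, 0 < t → h t =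
      (1 / t) *
        (1 - Real.exp (-t ^ 2) * ∑ k ∈ Finset.range d, t ^ (2 * k) / (Nat.factorial k : ℝ)) ^
          ((1 : ℝ) / (2 * d)) := by
  obtain ⟨n, rfl⟩ : ∃ n, d = n + 1 := ⟨d - 1, by omega⟩
  intro t ht
  have hconst : (t * h t) ^ (2 * (n + 1)) + Real.exp (-t ^ 2) *
      ∑ k ∈ Finset.range (n + 1), (t ^ 2) ^ k / (k.factorial : ℝ) = 1 := by
    refine eq_of_hasDerivAt_zero_of_tendsto_atTop (F := fun t => (t * h t) ^ (2 * (n + 1)) +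
      Real.exp (-t ^ 2) * ∑ k ∈ Finset.range (n + 1), (t ^ 2) ^ k / (k.factorial : ℝ)) ?_ ?_ ht
    · intro x hx
      have hpow := ((hasDerivAt_id' x).mul (hdiff x hx).hasDerivAt).pow (2 * (n + 1))
      have hsum := (hasDerivAt_exp_neg_mul_sum_pow_div_factorial n (x ^ 2)).comp x
        (hasDerivAt_pow 2 x)
      refine (hpow.add hsum).congr_deriv ?_
      have hx_ode := hode x hx
      have hn : (n.factorial : ℝ) ≠ 0 := by positivity
      rw [Nat.factorial_succ, show 2 * (n + 1) - 1 = 2 * n + 1 by omega] at hx_ode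
      rw [show 2 * (n + 1) - 1 = 2 * n + 1 by omega]
      have hrhs : Real.exp (-x ^ 2) / (n.factorial : ℝ) =
          (n + 1) * (h x ^ (2 * n + 1) * (h x + x * deriv h x)) := by
        rw [hx_ode]
        push_cast
        field_simp
      simp only [Pi.mul_apply, Nat.cast_mul, Nat.cast_add, Nat.cast_ofNat, Nat.cast_one, mul_pow]
      linear_combination (-2 * x ^ (2 * n + 1)) * hrhs
    · simpa using (hlim.pow (2 * (n + 1))).add
        ((tendsto_exp_neg_mul_sum_pow_div_factorial (n + 1)).comp
          (tendsto_pow_atTop (α := ℝ) two_ne_zero))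
  simp only [pow_mul t 2]
  rw [← eq_sub_iff_add_eq.2 hconst, one_div (2 * ((n + 1 : ℕ) : ℝ)),
    show 2 * ((n + 1 : ℕ) : ℝ) = ((2 * (n + 1) : ℕ) : ℝ) by push_cast; rfl,
    Real.pow_rpow_inv_natCast (hrange t ht).1 (by omega)]
  field_simp
end

section
/- For an integer d ≥ 1, define ϑ₂ : ℂ^d → ℂ^d by ϑ₂(z) = z·f_d(‖z‖) for z ≠ 0 and ϑ₂(0) = 0, where f_d(t) = (1/t)·(1 − e^{-t²} Σ_{k=0}^{d-1} t^{2k}/k!)^{1/(2d)}. Then ‖ϑ₂(z)‖ = g_d(‖z‖) < 1 for all z, where g_d(t) = t·f_d(t), and ϑ₂ is a bijection from ℂ^d onto the open Euclidean unit ball 𝔹 = {w ∈ ℂ^d : ‖w‖ < 1}. -/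
open MeasureTheory Real Finset Set

/-- The regularized incomplete gamma function `1 - e^{-x} ∑_{k<d} x^k/k!`. -/
noncomputable def regGamma (d : ℕ) (x : ℝ) : ℝ :=
  1 - Real.exp (-x) * ∑ k ∈ Finset.range d, x ^ k / (Nat.factorial k : ℝ)

theorem hasDerivAt_regGamma_succ (m : ℕ) (x : ℝ) :
    HasDerivAt (regGamma (m + 1)) (Real.exp (-x) * (x ^ m / (Nat.factorial m : ℝ))) x := by
  have hexp : HasDerivAt (fun y : ℝ => Real.exp (-y)) (-Real.exp (-x)) x := by
    simpa using (hasDerivAt_neg x).exp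
  induction m with
  | zero =>
    have h := hexp.const_sub 1
    have hone : regGamma (0 + 1) = fun y => 1 - Real.exp (-y) := by
      funext y
      simp [regGamma]
    rw [hone]
    simpa using h
  | succ m ih =>
    have hpow : HasDerivAt (fun y : ℝ => y ^ (m + 1) / (Nat.factorial (m + 1) : ℝ))
        (x ^ m / (Nat.factorial m : ℝ)) x := by
      refine ((hasDerivAt_pow (m + 1) x).div_const _).congr_deriv ?_
      have hm : (Nat.factorial m : ℝ) ≠ 0 := by positivity
      rw [Nat.factorial_succ]
      push_cast
      field_simp
    have hrec : regGamma (m + 1 + 1) = fun y => regGamma (m + 1) y -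
        Real.exp (-y) * (y ^ (m + 1) / (Nat.factorial (m + 1) : ℝ)) := by
      funext y
      simp only [regGamma]
      rw [Finset.sum_range_succ _ (m + 1)]
      ring
    rw [hrec]
    refine (ih.sub (hexp.mul hpow)).congr_deriv ?_
    ring

theorem continuous_regGamma (d : ℕ) : Continuous (regGamma d) := by
  unfold regGamma
  fun_prop

theorem regGamma_zero {d : ℕ} (hd : 1 ≤ d) : regGamma d 0 = 0 := by
  obtain ⟨m, rfl⟩ := Nat.exists_eq_add_of_le' hd
  simp [regGamma, Finset.sum_range_succ']

theorem strictMonoOn_regGamma {d : ℕ} (hd : 1 ≤ d) : StrictMonoOn (regGamma d) (Set.Ici 0) := by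
  obtain ⟨m, rfl⟩ := Nat.exists_eq_add_of_le' hd
  refine strictMonoOn_of_deriv_pos (convex_Ici 0) (continuous_regGamma _).continuousOn ?_
  intro x hx
  rw [interior_Ici, Set.mem_Ioi] at hx
  rw [(hasDerivAt_regGamma_succ m x).deriv]
  positivity

theorem regGamma_nonneg {d : ℕ} (hd : 1 ≤ d) {x : ℝ} (hx : 0 ≤ x) : 0 ≤ regGamma d x := by
  rw [← regGamma_zero hd]
  exact (strictMonoOn_regGamma hd).monotoneOn Set.self_mem_Ici hx hx

theorem regGamma_lt_one {d : ℕ} (hd : 1 ≤ d) {x : ℝ} (hx : 0 ≤ x) : regGamma d x < 1 := by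
  obtain ⟨m, rfl⟩ := Nat.exists_eq_add_of_le' hd
  have hsum : 0 < ∑ k ∈ Finset.range (m + 1), x ^ k / (Nat.factorial k : ℝ) := by
    rw [Finset.sum_range_succ']
    simp only [pow_zero, Nat.factorial_zero, Nat.cast_one, div_one]
    positivity
  have := mul_pos (Real.exp_pos (-x)) hsum
  unfold regGamma
  linarith

theorem tendsto_regGamma_atTop (d : ℕ) :
    Filter.Tendsto (regGamma d) Filter.atTop (nhds 1) := by
  have hsum : Filter.Tendsto
      (fun x : ℝ => ∑ k ∈ Finset.range d, x ^ k * Real.exp (-x) / (Nat.factorial k : ℝ))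
      Filter.atTop (nhds (∑ k ∈ Finset.range d, 0 / (Nat.factorial k : ℝ))) :=
    tendsto_finsetSum _ fun k _ =>
      (Real.tendsto_pow_mul_exp_neg_atTop_nhds_zero k).div_const _
  have h := hsum.const_sub 1
  simp only [zero_div, Finset.sum_const_zero, sub_zero] at h
  refine h.congr fun x => ?_
  rw [regGamma, Finset.mul_sum]
  congr 1
  exact Finset.sum_congr rfl fun k _ => by ring

theorem exists_regGamma_eq {d : ℕ} (hd : 1 ≤ d) {y : ℝ} (hy₀ : 0 < y) (hy₁ : y < 1) :
    ∃ x, 0 < x ∧ regGamma d x = y := by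
  obtain ⟨b, hyb, hb⟩ := (((tendsto_regGamma_atTop d).eventually_const_lt hy₁).and
    (Filter.eventually_ge_atTop 0)).exists
  obtain ⟨x, hx, rfl⟩ := intermediate_value_Icc hb (continuous_regGamma d).continuousOn
    ⟨(regGamma_zero hd).trans_le hy₀.le, hyb.le⟩
  refine ⟨x, hx.1.lt_of_ne ?_, rfl⟩
  rintro rfl
  exact hy₀.ne' (regGamma_zero hd)

/-- A radial map `z ↦ f ‖z‖ • z` whose radial profile `t ↦ t * f t` agrees with a strictly
increasing function `g` vanishing at `0` and mapping `(0, ∞)` onto `(0, 1)` is a bijection onto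
the open unit ball. -/
theorem bijOn_ball_of_radial {E : Type*} [NormedAddCommGroup E] [NormedSpace ℝ E]
    {f g : ℝ → ℝ} {θ : E → E} (hg0 : g 0 = 0) (hmono : StrictMonoOn g (Set.Ici 0))
    (hlt : ∀ t, 0 ≤ t → g t < 1) (hsurj : ∀ r, 0 < r → r < 1 → ∃ t, 0 < t ∧ g t = r)
    (hfg : ∀ t, 0 < t → t * f t = g t) (hθ0 : θ 0 = 0)
    (hθ : ∀ z, z ≠ 0 → θ z = f ‖z‖ • z) :
    (∀ z, ‖θ z‖ = ‖z‖ * f ‖z‖ ∧ ‖θ z‖ < 1) ∧ Set.BijOn θ Set.univ (Metric.ball 0 1) := by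
  have hfpos : ∀ t, 0 < t → 0 < f t := fun t ht => by
    have hgt : 0 < t * f t := by
      rw [hfg t ht, ← hg0]
      exact hmono Set.self_mem_Ici ht.le ht
    exact pos_of_mul_pos_right hgt ht.le
  have hnorm : ∀ z, ‖θ z‖ = ‖z‖ * f ‖z‖ := fun z => by
    rcases eq_or_ne z 0 with rfl | hz
    · simp [hθ0]
    · rw [hθ z hz, norm_smul, Real.norm_of_nonneg (hfpos _ (norm_pos_iff.2 hz)).le, mul_comm]
  have hnorm_g : ∀ z, ‖θ z‖ = g ‖z‖ := fun z => by
    rcases eq_or_ne z 0 with rfl | hz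
    · simp [hθ0, hg0]
    · rw [hnorm, hfg _ (norm_pos_iff.2 hz)]
  have hnorm_lt : ∀ z, ‖θ z‖ < 1 := fun z => (hnorm_g z).trans_lt (hlt _ (norm_nonneg z))
  refine ⟨fun z => ⟨hnorm z, hnorm_lt z⟩, fun z _ => mem_ball_zero_iff.2 (hnorm_lt z), ?_, ?_⟩
  · intro z _ w _ hzw
    have heq : ‖z‖ = ‖w‖ := hmono.injOn (norm_nonneg z) (norm_nonneg w) (by
      rw [← hnorm_g, ← hnorm_g, hzw])
    rcases eq_or_ne z 0 with rfl | hz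
    · rw [norm_zero] at heq
      exact (norm_eq_zero.1 heq.symm).symm
    · have hw : w ≠ 0 := norm_pos_iff.1 (heq ▸ norm_pos_iff.2 hz)
      rw [hθ z hz, hθ w hw, heq] at hzw
      exact smul_right_injective E (hfpos _ (norm_pos_iff.2 hw)).ne' hzw
  · intro w hw
    rw [mem_ball_zero_iff] at hw
    rcases eq_or_ne w 0 with rfl | hw0
    · exact ⟨0, Set.mem_univ _, hθ0⟩
    · have hwpos := norm_pos_iff.2 hw0
      obtain ⟨t, ht, hgt⟩ := hsurj _ hwpos hw
      have hz : ‖(t / ‖w‖) • w‖ = t := by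
        rw [norm_smul, Real.norm_of_nonneg (by positivity), div_mul_cancel₀ _ hwpos.ne']
      refine ⟨(t / ‖w‖) • w, Set.mem_univ _, ?_⟩
      rw [hθ _ (norm_pos_iff.1 (hz.symm ▸ ht)), hz, smul_smul, mul_div_assoc', mul_comm,
        hfg t ht, hgt, div_self hwpos.ne', one_smul]

/-- For an integer `d ≥ 1`, define `ϑ₂ : ℂ^d → ℂ^d` by
`ϑ₂(z) = z·f_d(‖z‖)` for `z ≠ 0` and `ϑ₂(0) = 0`, where
`f_d(t) = (1/t)·(1 − e^{-t²} Σ_{k=0}^{d-1} t^(2k)/k!)^(1/(2d))`. Then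
`‖ϑ₂(z)‖ = g_d(‖z‖) < 1` for all `z`, where `g_d(t) = t·f_d(t)`, and `ϑ₂` is a bijection from
`ℂ^d` onto the open unit ball `{w ∈ ℂ^d : ‖w‖ < 1}`. -/
theorem theta2_bijective_onto_ball
    (d : ℕ) (hd : 1 ≤ d) (f : ℝ → ℝ)
    (hf : ∀ t : ℝ, 0 < t → f t =
      (1 / t) *
        (1 - Real.exp (-t ^ 2) * ∑ k ∈ Finset.range d, t ^ (2 * k) / (Nat.factorial k : ℝ)) ^
          ((1 : ℝ) / (2 * d)))
    (θ : EuclideanSpace ℂ (Fin d) → EuclideanSpace ℂ (Fin d))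
    (hθ0 : θ 0 = 0)
    (hθ : ∀ z : EuclideanSpace ℂ (Fin d), z ≠ 0 → θ z = f ‖z‖ • z) :
    (∀ z : EuclideanSpace ℂ (Fin d), ‖θ z‖ = ‖z‖ * f ‖z‖ ∧ ‖θ z‖ < 1) ∧
      Set.BijOn θ Set.univ (Metric.ball (0 : EuclideanSpace ℂ (Fin d)) 1) := by
  have hp : (0 : ℝ) < 1 / (2 * d) := by positivity
  refine bijOn_ball_of_radial (f := f) (g := fun t => regGamma d (t ^ 2) ^ ((1 : ℝ) / (2 * d)))
    ?_ ?_ ?_ ?_ ?_ hθ0 hθ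
  · simp only [ne_eq, OfNat.ofNat_ne_zero, not_false_eq_true, zero_pow, regGamma_zero hd]
    exact Real.zero_rpow hp.ne'
  · intro s hs t ht hst
    exact Real.rpow_lt_rpow (regGamma_nonneg hd (sq_nonneg s))
      (strictMonoOn_regGamma hd (sq_nonneg s) (sq_nonneg t)
        (pow_lt_pow_left₀ hst hs two_ne_zero)) hp
  · intro t _
    exact Real.rpow_lt_one (regGamma_nonneg hd (sq_nonneg t)) (regGamma_lt_one hd (sq_nonneg t)) hp
  · intro r hr₀ hr₁
    obtain ⟨x, hx, hxr⟩ := exists_regGamma_eq hd (pow_pos hr₀ (2 * d))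
      (pow_lt_one₀ hr₀.le hr₁ (by positivity))
    refine ⟨√x, Real.sqrt_pos.2 hx, ?_⟩
    have h := Real.pow_rpow_inv_natCast hr₀.le (n := 2 * d) (by positivity)
    push_cast at h
    rw [Real.sq_sqrt hx.le, hxr, one_div, h]
  · intro t ht
    rw [hf t ht, ← mul_assoc, mul_one_div_cancel ht.ne', one_mul]
    simp only [regGamma, pow_mul]
end

section
/- For an integer d ≥ 1, let ϑ₂ : ℂ^d → ℂ^d be given by ϑ₂(z) = z·f_d(‖z‖) for z ≠ 0, where f_d(t) = (1/t)·(1 − e^{-t²} Σ_{k=0}^{d-1} t^{2k}/k!)^{1/(2d)}. Then for every z ≠ 0, ϑ₂ is differentiable at z as a map of real vector spaces (identifying ℂ^d with ℝ^{2d}), and the absolute value of the determinant of its (real) Fréchet derivative at z equals e^{-‖z‖²}/d!. -/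
open MeasureTheory Real Finset Set

/-- The derivative of the radial map `x ↦ G (‖x‖²) • x`. -/
theorem hasFDerivAt_radial {E : Type*} [NormedAddCommGroup E] [InnerProductSpace ℝ E]
    {G : ℝ → ℝ} {G' : ℝ} {z : E} (hG : HasDerivAt G G' (‖z‖ ^ 2)) :
    HasFDerivAt (fun x : E => G (‖x‖ ^ 2) • x)
      (G (‖z‖ ^ 2) • ContinuousLinearMap.id ℝ E +
        (G' • (2 • innerSL ℝ z)).smulRight z) z :=
  (hG.comp_hasFDerivAt z (hasStrictFDerivAt_norm_sq z).hasFDerivAt).smul (hasFDerivAt_id z)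

/-- The determinant of a nonzero homothety plus a rank one map. -/
theorem det_smul_id_add_smulRight {E : Type*} [NormedAddCommGroup E] [NormedSpace ℝ E]
    [FiniteDimensional ℝ E] {c : ℝ} (hc : c ≠ 0) (φ : E →L[ℝ] ℝ) (v : E) :
    (c • ContinuousLinearMap.id ℝ E + φ.smulRight v).det =
      c ^ Module.finrank ℝ E * (1 + c⁻¹ * φ v) := by
  have h : ((c • ContinuousLinearMap.id ℝ E + φ.smulRight v : E →L[ℝ] E) : E →ₗ[ℝ] E) =
      c • LinearMap.transvection (c⁻¹ • (φ : E →ₗ[ℝ] ℝ)) v := by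
    ext x
    simp [LinearMap.transvection.apply, smul_smul, hc]
  rw [ContinuousLinearMap.det, h, LinearMap.det_smul, LinearMap.transvection.det]
  simp

/-- The upper tail of the Poisson distribution, as a function of its parameter. -/
noncomputable def poissonTail (d : ℕ) (s : ℝ) : ℝ :=
  1 - Real.exp (-s) * ∑ k ∈ Finset.range d, s ^ k / (Nat.factorial k : ℝ)

theorem poissonTail_succ (d : ℕ) (s : ℝ) :
    poissonTail (d + 1) s = poissonTail d s - Real.exp (-s) * (s ^ d / (Nat.factorial d : ℝ)) := by
  rw [poissonTail, poissonTail, Finset.sum_range_succ]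
  ring

theorem hasDerivAt_poissonTail_succ (d : ℕ) (s : ℝ) :
    HasDerivAt (poissonTail (d + 1)) (Real.exp (-s) * (s ^ d / (Nat.factorial d : ℝ))) s := by
  have hexp : HasDerivAt (fun s : ℝ => Real.exp (-s)) (-Real.exp (-s)) s := by
    simpa using (hasDerivAt_neg s).exp
  induction d with
  | zero =>
    have h : poissonTail 1 = fun s => 1 - Real.exp (-s) := by
      funext s
      simp [poissonTail]
    rw [h]
    simpa using hexp.const_sub 1
  | succ d ih =>
    have h := ih.sub (hexp.mul ((hasDerivAt_pow (d + 1) s).div_const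
      ((d + 1).factorial : ℝ)))
    rw [funext (poissonTail_succ (d + 1))]
    refine h.congr_deriv ?_
    rw [Nat.factorial_succ]
    push_cast
    have := Nat.cast_ne_zero (R := ℝ).2 d.factorial_ne_zero
    have : (d : ℝ) + 1 ≠ 0 := by positivity
    field_simp
    ring

theorem poissonTail_pos (d : ℕ) {s : ℝ} (hs : 0 < s) : 0 < poissonTail d s := by
  have h : ∑ k ∈ Finset.range d, s ^ k / (Nat.factorial k : ℝ) < Real.exp s := by
    refine lt_of_lt_of_le ?_ (Real.sum_le_exp_of_nonneg hs.le (d + 1))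
    rw [Finset.sum_range_succ]
    have : 0 < s ^ d / (Nat.factorial d : ℝ) := by positivity
    linarith
  have h' := mul_lt_mul_of_pos_left h (Real.exp_pos (-s))
  rw [← Real.exp_add, neg_add_cancel, Real.exp_zero] at h'
  exact sub_pos.2 h'

theorem hasDerivAt_poissonTail_div_pow {d : ℕ} (hd : 1 ≤ d) {s : ℝ} (hs : s ≠ 0) :
    HasDerivAt (fun s => poissonTail d s / s ^ d)
      (d / s * (Real.exp (-s) / (Nat.factorial d : ℝ) - poissonTail d s / s ^ d)) s := by
  obtain ⟨e, rfl⟩ := Nat.exists_eq_add_of_le' hd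
  refine ((hasDerivAt_poissonTail_succ e s).div (hasDerivAt_pow (e + 1) s)
    (pow_ne_zero _ hs)).congr_deriv ?_
  have := Nat.cast_ne_zero (R := ℝ).2 e.factorial_ne_zero
  have : (e : ℝ) + 1 ≠ 0 := by positivity
  rw [Nat.factorial_succ]
  push_cast
  field_simp
  ring

theorem hasDerivAt_rpow_one_div {H : ℝ → ℝ} {H' s : ℝ} (hH : HasDerivAt H H' s)
    (hs : 0 < H s) {n : ℝ} (hn : n ≠ 0) :
    HasDerivAt (fun x => H x ^ (1 / n)) (H s ^ (1 / n) * H' / (n * H s)) s := by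
  refine (hH.rpow_const (Or.inl hs.ne')).congr_deriv ?_
  rw [Real.rpow_sub_one hs.ne']
  field_simp

/-- For an integer `d ≥ 1`, let `ϑ₂(z) = z·f_d(‖z‖)` for `z ≠ 0`, where
`f_d(t) = (1/t)·(1 − e^{-t²} Σ_{k=0}^{d-1} t^(2k)/k!)^(1/(2d))`. Then for every `z ≠ 0`,
`ϑ₂` is differentiable at `z` as a map of real vector spaces (identifying `ℂ^d` with
`ℝ^(2d)`), and the absolute value of the determinant of its real Fréchet derivative at `z`
equals `e^{-‖z‖²}/d!`. -/
theorem theta2_jacobian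
    (d : ℕ) (hd : 1 ≤ d) (f : ℝ → ℝ)
    (hf : ∀ t : ℝ, 0 < t → f t =
      (1 / t) *
        (1 - Real.exp (-t ^ 2) * ∑ k ∈ Finset.range d, t ^ (2 * k) / (Nat.factorial k : ℝ)) ^
          ((1 : ℝ) / (2 * d)))
    (θ : EuclideanSpace ℂ (Fin d) → EuclideanSpace ℂ (Fin d))
    (hθ : ∀ z : EuclideanSpace ℂ (Fin d), z ≠ 0 → θ z = f ‖z‖ • z)
    (z : EuclideanSpace ℂ (Fin d)) (hz : z ≠ 0) :
    DifferentiableAt ℝ θ z ∧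
      |(fderiv ℝ θ z).det| = Real.exp (-‖z‖ ^ 2) / (Nat.factorial d : ℝ) := by
  have hn : (2 * d : ℝ) ≠ 0 := by positivity
  have hs : 0 < ‖z‖ ^ 2 := by positivity
  set G : ℝ → ℝ := fun s => (poissonTail d s / s ^ d) ^ (1 / (2 * d : ℝ)) with hGdef
  have hfG : ∀ t : ℝ, 0 < t → f t = G (t ^ 2) := by
    intro t ht
    have hroot : ((t ^ 2) ^ d) ^ (1 / (2 * d : ℝ)) = t := by
      rw [← pow_mul, one_div]
      exact_mod_cast Real.pow_rpow_inv_natCast ht.le (n := 2 * d) (by omega)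
    simp only [hGdef]
    rw [hf t ht, Real.div_rpow (poissonTail_pos d (by positivity)).le (by positivity), hroot,
      poissonTail]
    simp only [pow_mul]
    ring
  have hHpos : 0 < poissonTail d (‖z‖ ^ 2) / (‖z‖ ^ 2) ^ d :=
    div_pos (poissonTail_pos d hs) (by positivity)
  have hG := hasDerivAt_rpow_one_div (hasDerivAt_poissonTail_div_pow hd hs.ne') hHpos hn
  have hGpos : 0 < G (‖z‖ ^ 2) := Real.rpow_pos_of_pos hHpos _
  have hGpow : G (‖z‖ ^ 2) ^ (2 * d) = poissonTail d (‖z‖ ^ 2) / (‖z‖ ^ 2) ^ d := by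
    simp only [hGdef, one_div]
    exact_mod_cast Real.rpow_inv_natCast_pow hHpos.le (n := 2 * d) (by omega)
  have hfin : Module.finrank ℝ (EuclideanSpace ℂ (Fin d)) = 2 * d := by
    rw [finrank_real_of_complex, finrank_euclideanSpace_fin]
  have hθG : θ =ᶠ[nhds z] fun x => G (‖x‖ ^ 2) • x := by
    filter_upwards [isOpen_ne.mem_nhds hz] with x hx
    rw [hθ x hx, hfG _ (norm_pos_iff.2 hx)]
  have hderiv := (hasFDerivAt_radial hG).congr_of_eventuallyEq hθG
  refine ⟨hderiv.differentiableAt, ?_⟩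
  have hd' : (d : ℝ) ≠ 0 := by positivity
  rw [hderiv.fderiv, det_smul_id_add_smulRight hGpos.ne', hfin, hGpow]
  have hval : ∀ g h s e : ℝ, g ≠ 0 → h ≠ 0 → s ≠ 0 →
      h * (1 + g⁻¹ * (g * (d / s * (e - h)) / (2 * d * h) * (2 * s))) = e := by
    intro g h s e hg hh hs
    field_simp
    ring
  simp only [smul_apply, innerSL_apply_apply, real_inner_self_eq_norm_sq,
    smul_eq_mul, nsmul_eq_mul, Nat.cast_ofNat]
  rw [hval _ _ _ _ hGpos.ne' hHpos.ne' hs.ne', abs_of_pos (by positivity)]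
end

section
/- For an integer d ≥ 1, let ϑ₂ : ℂ^d → ℂ^d be given by ϑ₂(z) = z·f_d(‖z‖) for z ≠ 0 and ϑ₂(0) = 0, where f_d(t) = (1/t)·(1 − e^{-t²} Σ_{k=0}^{d-1} t^{2k}/k!)^{1/(2d)}. Then for every integrable g : ℂ^d → ℂ one has ∫_{ℂ^d} g(ϑ₂(z)) e^{-‖z‖²} dz = d! · ∫_{𝔹} g(w) dw, where 𝔹 = {w ∈ ℂ^d : ‖w‖ < 1} is the open unit ball. Equivalently, if z is a standard complex Gaussian vector in ℂ^d with density π^{-d} e^{-‖z‖²}, then ϑ₂(z) is uniformly distributed in 𝔹. -/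
open MeasureTheory Real Finset Set

noncomputable instance (d : ℕ) : MeasurableSpace (EuclideanSpace ℂ (Fin d)) := borel _
instance (d : ℕ) : BorelSpace (EuclideanSpace ℂ (Fin d)) := ⟨rfl⟩

/-- Integration of a nonnegative function in polar coordinates. -/
lemma lintegral_eq_lintegral_toSphere_lintegral_Ioi {E : Type*} [NormedAddCommGroup E]
    [NormedSpace ℝ E] [FiniteDimensional ℝ E] [MeasurableSpace E] [BorelSpace E] [Nontrivial E]
    (μ : Measure E) [μ.IsAddHaarMeasure] {φ : E → ENNReal} (hφ : Measurable φ) :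
    ∫⁻ x, φ x ∂μ = ∫⁻ ω, (∫⁻ r in Set.Ioi (0 : ℝ),
      ENNReal.ofReal (r ^ (Module.finrank ℝ E - 1)) * φ (r • (ω : E))) ∂μ.toSphere := by
  have hmeas : Measurable fun p : Metric.sphere (0 : E) 1 × Set.Ioi (0 : ℝ) ↦
      φ ((p.2 : ℝ) • (p.1 : E)) := hφ.comp (by fun_prop)
  calc
    ∫⁻ x, φ x ∂μ = ∫⁻ x : ({0}ᶜ : Set E), φ x ∂(μ.comap (↑)) := by
      rw [lintegral_subtype_comap (measurableSet_singleton _).compl, restrict_compl_singleton]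
    _ = ∫⁻ p, φ ((p.2 : ℝ) • (p.1 : E))
          ∂μ.toSphere.prod (.volumeIoiPow (Module.finrank ℝ E - 1)) := by
      rw [← μ.measurePreserving_homeomorphUnitSphereProd.lintegral_comp hmeas]
      refine lintegral_congr fun x ↦ ?_
      have hx : ‖(x : E)‖ ≠ 0 := norm_ne_zero_iff.2 x.2
      simp [smul_smul, hx]
    _ = ∫⁻ ω, ∫⁻ r : Set.Ioi (0 : ℝ), φ ((r : ℝ) • (ω : E))
          ∂(.volumeIoiPow (Module.finrank ℝ E - 1)) ∂μ.toSphere :=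
      lintegral_prod _ hmeas.aemeasurable
    _ = _ := by
      refine lintegral_congr fun ω ↦ ?_
      have hray : Measurable fun r : Set.Ioi (0 : ℝ) ↦ φ ((r : ℝ) • (ω : E)) :=
        hφ.comp (by fun_prop)
      rw [Measure.volumeIoiPow, lintegral_withDensity_eq_lintegral_mul _ (by fun_prop) hray,
        ← lintegral_subtype_comap measurableSet_Ioi]
      rfl

/-- The distribution function of the norm of a standard complex Gaussian vector in `ℂ^d`. -/
noncomputable def gaussianRadialCDF (d : ℕ) (t : ℝ) : ℝ :=
  1 - Real.exp (-t ^ 2) * ∑ k ∈ Finset.range d, t ^ (2 * k) / (Nat.factorial k : ℝ)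

lemma hasDerivAt_gaussianRadialCDF (n : ℕ) (t : ℝ) :
    HasDerivAt (gaussianRadialCDF (n + 1))
      (2 * t ^ (2 * n + 1) * Real.exp (-t ^ 2) / (Nat.factorial n : ℝ)) t := by
  have hexp : HasDerivAt (fun t : ℝ ↦ Real.exp (-t ^ 2)) (Real.exp (-t ^ 2) * (-(2 * t))) t := by
    simpa using ((hasDerivAt_pow 2 t).neg).exp
  induction n with
  | zero =>
    have hfun : gaussianRadialCDF (0 + 1) = fun t ↦ 1 - Real.exp (-t ^ 2) := by
      ext s
      simp [gaussianRadialCDF]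
    rw [hfun]
    refine (hexp.const_sub 1).congr_deriv ?_
    simp only [mul_zero, zero_add, pow_one, Nat.factorial_zero, Nat.cast_one, div_one]
    ring
  | succ n ih =>
    have hfun : gaussianRadialCDF (n + 1 + 1) = fun t ↦ gaussianRadialCDF (n + 1) t -
        Real.exp (-t ^ 2) * (t ^ (2 * (n + 1)) / (Nat.factorial (n + 1) : ℝ)) := by
      ext s
      simp only [gaussianRadialCDF, Finset.sum_range_succ _ (n + 1)]
      ring
    rw [hfun]
    refine (ih.sub (hexp.mul ((hasDerivAt_pow (2 * (n + 1)) t).div_const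
      (Nat.factorial (n + 1) : ℝ)))).congr_deriv ?_
    rw [show 2 * (n + 1) - 1 = 2 * n + 1 by omega]
    push_cast [Nat.factorial_succ]
    field_simp
    ring

lemma gaussianRadialCDF_zero (n : ℕ) : gaussianRadialCDF (n + 1) 0 = 0 := by
  simp [gaussianRadialCDF, Finset.sum_range_succ']

lemma continuous_gaussianRadialCDF (d : ℕ) : Continuous (gaussianRadialCDF d) := by
  unfold gaussianRadialCDF
  fun_prop

lemma strictMonoOn_gaussianRadialCDF (n : ℕ) :
    StrictMonoOn (gaussianRadialCDF (n + 1)) (Set.Ici 0) := by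
  refine strictMonoOn_of_deriv_pos (convex_Ici 0)
    (continuous_gaussianRadialCDF _).continuousOn fun t ht ↦ ?_
  rw [interior_Ici, Set.mem_Ioi] at ht
  rw [(hasDerivAt_gaussianRadialCDF n t).deriv]
  positivity

lemma gaussianRadialCDF_pos (n : ℕ) {t : ℝ} (ht : 0 < t) : 0 < gaussianRadialCDF (n + 1) t := by
  simpa [gaussianRadialCDF_zero] using
    strictMonoOn_gaussianRadialCDF n Set.self_mem_Ici ht.le ht

lemma gaussianRadialCDF_lt_one (n : ℕ) {t : ℝ} (ht : 0 < t) : gaussianRadialCDF (n + 1) t < 1 := by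
  have : 0 < ∑ k ∈ Finset.range (n + 1), t ^ (2 * k) / (Nat.factorial k : ℝ) :=
    Finset.sum_pos (fun k _ ↦ by positivity) (by simp)
  have := mul_pos (Real.exp_pos (-t ^ 2)) this
  simp only [gaussianRadialCDF]
  linarith

lemma tendsto_gaussianRadialCDF_atTop (d : ℕ) :
    Filter.Tendsto (gaussianRadialCDF d) Filter.atTop (nhds 1) := by
  have key (k : ℕ) : Filter.Tendsto (fun t : ℝ ↦ Real.exp (-t ^ 2) *
      (t ^ (2 * k) / (Nat.factorial k : ℝ))) Filter.atTop (nhds 0) := by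
    have h := ((Real.tendsto_pow_mul_exp_neg_atTop_nhds_zero k).comp
      (Filter.tendsto_pow_atTop (α := ℝ) two_ne_zero)).div_const (Nat.factorial k : ℝ)
    rw [zero_div] at h
    refine h.congr fun t ↦ ?_
    simp only [Function.comp_apply, pow_mul]
    ring
  have h := (tendsto_finsetSum (Finset.range d) fun k _ ↦ key k).const_sub 1
  simp only [Finset.sum_const_zero, sub_zero, ← Finset.mul_sum] at h
  exact h

/-- The radial profile `t ↦ t * f_d(t)` of the map `ϑ₂`. -/
noncomputable def radialProfile (d : ℕ) (t : ℝ) : ℝ :=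
  gaussianRadialCDF d t ^ ((1 : ℝ) / (2 * d))

lemma continuous_radialProfile (d : ℕ) : Continuous (radialProfile d) :=
  (continuous_gaussianRadialCDF d).rpow_const fun _ ↦ Or.inr (by positivity)

lemma injOn_radialProfile (n : ℕ) : InjOn (radialProfile (n + 1)) (Set.Ioi 0) := by
  intro s hs t ht h
  refine (strictMonoOn_gaussianRadialCDF n).injOn (Set.mem_Ici.2 (le_of_lt hs))
    (Set.mem_Ici.2 (le_of_lt ht)) ?_
  exact (Real.rpow_left_inj (gaussianRadialCDF_pos n hs).le (gaussianRadialCDF_pos n ht).le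
    (by positivity)).1 h

lemma image_radialProfile (n : ℕ) : radialProfile (n + 1) '' Set.Ioi 0 = Set.Ioo 0 1 := by
  refine Subset.antisymm ?_ ?_
  · rintro _ ⟨t, ht, rfl⟩
    exact ⟨Real.rpow_pos_of_pos (gaussianRadialCDF_pos n ht) _,
      Real.rpow_lt_one (gaussianRadialCDF_pos n ht).le (gaussianRadialCDF_lt_one n ht)
        (by positivity)⟩
  · have h0 : Filter.Tendsto (radialProfile (n + 1)) (nhdsWithin 0 (Set.Ioi 0)) (nhds 0) := by
      have h := (continuous_radialProfile (n + 1)).tendsto 0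
      have e : radialProfile (n + 1) 0 = 0 := by
        rw [radialProfile, gaussianRadialCDF_zero, Real.zero_rpow (by positivity)]
      rw [e] at h
      exact h.mono_left nhdsWithin_le_nhds
    have h1 : Filter.Tendsto (radialProfile (n + 1)) Filter.atTop (nhds 1) := by
      have h := (tendsto_gaussianRadialCDF_atTop (n + 1)).rpow_const
        (p := (1 : ℝ) / (2 * (n + 1 : ℕ))) (Or.inl one_ne_zero)
      rwa [Real.one_rpow] at h
    exact isPreconnected_Ioi.intermediate_value_Ioo
      (Filter.le_principal_iff.2 self_mem_nhdsWithin)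
      (Filter.le_principal_iff.2 (Filter.Ioi_mem_atTop 0))
      (continuous_radialProfile _).continuousOn h0 h1

lemma exists_hasDerivAt_radialProfile (n : ℕ) {t : ℝ} (ht : 0 < t) :
    ∃ h' : ℝ, 0 ≤ h' ∧ HasDerivAt (radialProfile (n + 1)) h' t ∧
      (Nat.factorial (n + 1) : ℝ) * (h' * radialProfile (n + 1) t ^ (2 * n + 1)) =
        t ^ (2 * n + 1) * Real.exp (-t ^ 2) := by
  have hF := gaussianRadialCDF_pos n ht
  refine ⟨_, ?_, (hasDerivAt_gaussianRadialCDF n t).rpow_const (Or.inl hF.ne'), ?_⟩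
  · positivity
  · have hpow : gaussianRadialCDF (n + 1) t ^ ((1 : ℝ) / (2 * (n + 1 : ℕ)) - 1) *
        radialProfile (n + 1) t ^ (2 * n + 1) = 1 := by
      rw [radialProfile, ← Real.rpow_natCast, ← Real.rpow_mul hF.le, ← Real.rpow_add hF]
      convert Real.rpow_zero _ using 2
      push_cast
      field_simp
      ring
    have hn : (Nat.factorial n : ℝ) ≠ 0 := by positivity
    rw [mul_assoc (_ * _), hpow]
    push_cast [Nat.factorial_succ]
    field_simp

lemma lintegral_Ioi_comp_radialProfile (n : ℕ) (φ : ℝ → ENNReal) :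
    ∫⁻ t in Set.Ioi (0 : ℝ), ENNReal.ofReal (t ^ (2 * n + 1)) *
        (ENNReal.ofReal (Real.exp (-t ^ 2)) * φ (radialProfile (n + 1) t)) =
      (Nat.factorial (n + 1) : ENNReal) *
        ∫⁻ r in Set.Ioo (0 : ℝ) 1, ENNReal.ofReal (r ^ (2 * n + 1)) * φ r := by
  choose! h' hpos hderiv heq using fun (t : ℝ) (ht : 0 < t) ↦ exists_hasDerivAt_radialProfile n ht
  rw [← image_radialProfile n, lintegral_image_eq_lintegral_abs_deriv_mul measurableSet_Ioi
    (fun t ht ↦ (hderiv t ht).hasDerivWithinAt) (injOn_radialProfile n),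
    ← lintegral_const_mul' _ _ (ENNReal.natCast_ne_top _)]
  refine setLIntegral_congr_fun measurableSet_Ioi fun t (ht : 0 < t) ↦ ?_
  rw [abs_of_nonneg (hpos t ht), ← mul_assoc, ← ENNReal.ofReal_mul (by positivity), ← heq t ht,
    ENNReal.ofReal_mul (by positivity), ENNReal.ofReal_mul (hpos t ht), ENNReal.ofReal_natCast]
  ring

/-- The change of variables formula for the map `z ↦ (h(‖z‖) / ‖z‖) • z`, where `h` is the radial
profile, on a real normed space of dimension `2 * (n + 1)`. -/
lemma lintegral_exp_neg_sq_mul_comp_radialProfile {E : Type*} [NormedAddCommGroup E]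
    [NormedSpace ℝ E] [FiniteDimensional ℝ E] [MeasurableSpace E] [BorelSpace E]
    (μ : Measure E) [μ.IsAddHaarMeasure] {n : ℕ} (hE : Module.finrank ℝ E = 2 * (n + 1))
    {φ : E → ENNReal} (hφ : Measurable φ) :
    ∫⁻ z, ENNReal.ofReal (Real.exp (-‖z‖ ^ 2)) * φ ((radialProfile (n + 1) ‖z‖ / ‖z‖) • z) ∂μ =
      (Nat.factorial (n + 1) : ENNReal) * ∫⁻ w in Metric.ball (0 : E) 1, φ w ∂μ := by
  have : Nontrivial E := Module.nontrivial_of_finrank_pos (R := ℝ) (by omega)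
  have hdim : Module.finrank ℝ E - 1 = 2 * n + 1 := by omega
  have hprof : Measurable (radialProfile (n + 1)) := (continuous_radialProfile _).measurable
  have hcomp : Measurable fun z : E ↦ φ ((radialProfile (n + 1) ‖z‖ / ‖z‖) • z) :=
    hφ.comp (by fun_prop)
  rw [← lintegral_indicator measurableSet_ball,
    lintegral_eq_lintegral_toSphere_lintegral_Ioi μ (by fun_prop),
    lintegral_eq_lintegral_toSphere_lintegral_Ioi μ (hφ.indicator measurableSet_ball),
    ← lintegral_const_mul' _ _ (ENNReal.natCast_ne_top _), hdim]
  refine lintegral_congr fun ω ↦ ?_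
  have hω : ‖(ω : E)‖ = 1 := by simp
  have hnorm {t : ℝ} (ht : 0 < t) : ‖t • (ω : E)‖ = t := by
    rw [norm_smul, hω, mul_one, Real.norm_of_nonneg ht.le]
  trans ∫⁻ t in Set.Ioi (0 : ℝ), ENNReal.ofReal (t ^ (2 * n + 1)) *
        (ENNReal.ofReal (Real.exp (-t ^ 2)) * φ (radialProfile (n + 1) t • (ω : E)))
  · refine setLIntegral_congr_fun measurableSet_Ioi fun t (ht : 0 < t) ↦ ?_
    simp only [hnorm ht, smul_smul, div_mul_cancel₀ _ ht.ne']
  rw [lintegral_Ioi_comp_radialProfile n fun r ↦ φ (r • (ω : E)), ← Set.Ioi_inter_Iio, inter_comm,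
    ← setLIntegral_indicator measurableSet_Iio]
  congr 1
  refine setLIntegral_congr_fun measurableSet_Ioi fun t (ht : 0 < t) ↦ ?_
  by_cases h1 : t < 1 <;> simp [indicator, hnorm ht, h1]

/-- For an integer `d ≥ 1`, let `ϑ₂(z) = z·f_d(‖z‖)` for `z ≠ 0` and
`ϑ₂(0) = 0`, with `f_d(t) = (1/t)·(1 − e^{-t²} Σ_{k=0}^{d-1} t^(2k)/k!)^(1/(2d))`. Then for
every integrable `g : ℂ^d → ℂ`,
`∫_{ℂ^d} g(ϑ₂(z)) e^{-‖z‖²} dz = d! · ∫_𝔹 g(w) dw`,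
where `𝔹` is the open unit ball of `ℂ^d ≅ ℝ^(2d)` (with Lebesgue measure). -/
theorem theta2_pushforward_gaussian_to_uniform_ball
    (d : ℕ) (hd : 1 ≤ d) (f : ℝ → ℝ)
    (hf : ∀ t : ℝ, 0 < t → f t =
      (1 / t) *
        (1 - Real.exp (-t ^ 2) * ∑ k ∈ Finset.range d, t ^ (2 * k) / (Nat.factorial k : ℝ)) ^
          ((1 : ℝ) / (2 * d)))
    (θ : EuclideanSpace ℂ (Fin d) → EuclideanSpace ℂ (Fin d))
    (hθ0 : θ 0 = 0)
    (hθ : ∀ z : EuclideanSpace ℂ (Fin d), z ≠ 0 → θ z = f ‖z‖ • z)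
    (g : EuclideanSpace ℂ (Fin d) → ℂ) (hg : Integrable g) :
    ∫ z : EuclideanSpace ℂ (Fin d), Real.exp (-‖z‖ ^ 2) • g (θ z) =
      (Nat.factorial d : ℝ) • ∫ w in Metric.ball (0 : EuclideanSpace ℂ (Fin d)) 1, g w := by
  obtain ⟨n, rfl⟩ : ∃ n, d = n + 1 := ⟨d - 1, by omega⟩
  have hθ_eq : θ = fun z ↦ (radialProfile (n + 1) ‖z‖ / ‖z‖) • z := by
    ext1 z
    rcases eq_or_ne z 0 with rfl | hz
    · simp [hθ0]
    · rw [hθ z hz, hf _ (norm_pos_iff.2 hz), one_div_mul_eq_div]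
      rfl
  have hprof : Measurable (radialProfile (n + 1)) := (continuous_radialProfile _).measurable
  have hθ_meas : Measurable θ := by
    rw [hθ_eq]
    fun_prop
  have hmap : (volume.withDensity fun z : EuclideanSpace ℂ (Fin (n + 1)) ↦
      ENNReal.ofReal (Real.exp (-‖z‖ ^ 2))).map θ =
        (Nat.factorial (n + 1) : ENNReal) • volume.restrict (Metric.ball 0 1) := by
    refine Measure.ext_of_lintegral _ fun φ hφ ↦ ?_
    have hcomp : Measurable fun z ↦ φ (θ z) := hφ.comp hθ_meas
    rw [lintegral_map hφ hθ_meas, lintegral_withDensity_eq_lintegral_mul _ (by fun_prop) hcomp,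
      lintegral_smul_measure, hθ_eq]
    exact lintegral_exp_neg_sq_mul_comp_radialProfile volume
      (by simp [finrank_real_of_complex]) hφ
  have hg' : AEStronglyMeasurable g ((volume.withDensity fun z : EuclideanSpace ℂ (Fin (n + 1)) ↦
      ENNReal.ofReal (Real.exp (-‖z‖ ^ 2))).map θ) := by
    rw [hmap]
    exact hg.aestronglyMeasurable.restrict.smul_measure _
  have h := integral_map hθ_meas.aemeasurable hg'
  rw [hmap, integral_smul_measure, ENNReal.toReal_natCast,
    integral_withDensity_eq_integral_toReal_smul (by fun_prop) (by simp)] at h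
  rw [h]
  simp [ENNReal.toReal_ofReal, Real.exp_nonneg]
end

section
/- Fix an integer T ≥ 2. For every integrable f : ℂ^{T−1} → ℂ one has ∫_{ℂ^{T−1}} f(a) · (1 + ‖a‖²)^{-T} da = ∫_{{w ∈ ℂ^{T−1} : ‖w‖ < 1}} f(w / √(1 − ‖w‖²)) dw, where both integrals are with respect to Lebesgue measure on ℂ^{T−1} ≅ ℝ^{2(T−1)}. -/
open MeasureTheory Real Set

namespace OpenPartialHomeomorph

variable {E : Type*} [NormedAddCommGroup E] [InnerProductSpace ℝ E]

/-- The derivative `h ↦ c • (h - c² ⟪a, h⟫ a)`, where `c = (1 + ‖a‖²)^(-1/2)`, of the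
radial map `a ↦ (1 + ‖a‖²)^(-1/2) • a` onto the unit ball. -/
noncomputable def univUnitBallFDeriv (a : E) : E →L[ℝ] E :=
  (√(1 + ‖a‖ ^ 2))⁻¹ •
    (ContinuousLinearMap.id ℝ E + (-(1 + ‖a‖ ^ 2)⁻¹ • innerSL ℝ a).smulRight a)

theorem hasFDerivAt_univUnitBall (a : E) :
    HasFDerivAt (univUnitBall : E → E) (univUnitBallFDeriv a) a := by
  have hpos : 0 < 1 + ‖a‖ ^ 2 := by positivity
  have hsqrt : √(1 + ‖a‖ ^ 2) ≠ 0 := (Real.sqrt_pos.2 hpos).ne'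
  have hnorm : HasFDerivAt (fun x : E ↦ 1 + ‖x‖ ^ 2) (2 • innerSL ℝ a) a :=
    (hasStrictFDerivAt_norm_sq a).hasFDerivAt.const_add 1
  have hscale := (hasDerivAt_inv hsqrt).comp_hasFDerivAt a (hnorm.sqrt hpos.ne')
  refine (hscale.smul (hasFDerivAt_id a)).congr_fderiv ?_
  ext1 h
  simp only [univUnitBallFDeriv, Function.comp_apply, add_apply,
    smul_apply, ContinuousLinearMap.smulRight_apply,
    ContinuousLinearMap.id_apply, innerSL_apply_apply, id_eq, smul_add, smul_smul, smul_eq_mul,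
    nsmul_eq_mul]
  congr 2
  rw [Real.sq_sqrt hpos.le]
  field_simp
  push_cast
  ring

theorem det_univUnitBallFDeriv [FiniteDimensional ℝ E] (a : E) :
    (univUnitBallFDeriv a).det = (√(1 + ‖a‖ ^ 2))⁻¹ ^ (Module.finrank ℝ E + 2) := by
  have hpos : 0 < 1 + ‖a‖ ^ 2 := by positivity
  have hcoe : (univUnitBallFDeriv a : E →ₗ[ℝ] E) = (√(1 + ‖a‖ ^ 2))⁻¹ •
      LinearMap.transvection
        ((-(1 + ‖a‖ ^ 2)⁻¹ • innerSL ℝ a : E →L[ℝ] ℝ) : E →ₗ[ℝ] ℝ) a :=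
    rfl
  rw [ContinuousLinearMap.det, hcoe, LinearMap.det_smul, LinearMap.transvection.det, pow_add,
    inv_pow _ 2, Real.sq_sqrt hpos.le]
  congr 1
  simp only [ContinuousLinearMap.coe_coe, smul_apply, innerSL_apply_apply,
    real_inner_self_eq_norm_sq, smul_eq_mul]
  field_simp
  ring

/-- Change of variables along the radial map `a ↦ (1 + ‖a‖²)^(-1/2) • a` onto the unit ball. -/
theorem integral_smul_eq_setIntegral_ball_univUnitBall_symm [FiniteDimensional ℝ E]
    [MeasurableSpace E] [BorelSpace E] {F : Type*} [NormedAddCommGroup F] [NormedSpace ℝ F]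
    (μ : Measure E) [μ.IsAddHaarMeasure] (f : E → F) :
    ∫ a, (√(1 + ‖a‖ ^ 2))⁻¹ ^ (Module.finrank ℝ E + 2) • f a ∂μ =
      ∫ w in Metric.ball (0 : E) 1, f (univUnitBall.symm w) ∂μ := by
  have himage : (univUnitBall : E → E) '' univ = Metric.ball 0 1 :=
    (univUnitBall (E := E)).image_source_eq_target
  have hchange := integral_image_eq_integral_abs_det_fderiv_smul μ MeasurableSet.univ
    (fun a _ ↦ (hasFDerivAt_univUnitBall a).hasFDerivWithinAt) (univUnitBall (E := E)).injOn
    (fun w ↦ f (univUnitBall.symm w))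
  rw [himage, setIntegral_univ] at hchange
  rw [hchange]
  refine integral_congr_ae (.of_forall fun a ↦ ?_)
  dsimp only
  rw [det_univUnitBallFDeriv, abs_of_nonneg (by positivity),
    (univUnitBall (E := E)).left_inv (mem_univ a)]

end OpenPartialHomeomorph

/-- Fix an integer `T ≥ 2`. For every integrable `f : ℂ^{T−1} → ℂ`,
`∫_{ℂ^{T−1}} f(a)·(1 + ‖a‖²)^{-T} da = ∫_{‖w‖ < 1} f(w/√(1 − ‖w‖²)) dw`,
both integrals with respect to Lebesgue measure on `ℂ^{T−1} ≅ ℝ^{2(T−1)}`. -/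
theorem change_of_variables_ball_M_eq_one
    (T : ℕ) (hT : 2 ≤ T)
    (f : EuclideanSpace ℂ (Fin (T - 1)) → ℂ) (hf : Integrable f) :
    ∫ a : EuclideanSpace ℂ (Fin (T - 1)), (((1 + ‖a‖ ^ 2) ^ T)⁻¹ : ℝ) • f a =
      ∫ w in Metric.ball (0 : EuclideanSpace ℂ (Fin (T - 1))) 1,
        f ((Real.sqrt (1 - ‖w‖ ^ 2))⁻¹ • w) := by
  have hfinrank : Module.finrank ℝ (EuclideanSpace ℂ (Fin (T - 1))) + 2 = 2 * T := by
    rw [finrank_real_of_complex, finrank_euclideanSpace_fin]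
    lia
  have hchange :=
    OpenPartialHomeomorph.integral_smul_eq_setIntegral_ball_univUnitBall_symm volume f
  simp only [hfinrank, OpenPartialHomeomorph.univUnitBall_symm_apply] at hchange
  rw [← hchange]
  congr with a
  rw [pow_mul, inv_pow _ 2, Real.sq_sqrt (by positivity), inv_pow]
end
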